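/- Let T be a tree of pathwidth ℓ ≥ 2. Then there exists a simple path P in T such that deleting the vertices of P from T leaves a forest in which every connected component (tree) has pathwidth at most ℓ − 1. -/

import Mathlib

open scoped BigOperators

/-- A path decomposition of `G` with `t` bags. -/
def IsPathDecomp {V : Type*} (G : SimpleGraph V) (t : ℕ) (X : Fin t → Finset V) : Prop :=
  (∀ v : V, ∃ i, v ∈ X i) ∧
  (∀ ⦃u v : V⦄, G.Adj u v → ∃ i, u ∈ X i ∧ v ∈ X i) ∧
  (∀ (v : V) (i j l : Fin t), i ≤ j → j ≤ l → v ∈ X i → v ∈ X l → v ∈ X j)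

/-- The pathwidth of `G` is at most `k`. -/
def pathwidthLE {V : Type*} (G : SimpleGraph V) (k : ℕ) : Prop :=
  ∃ (t : ℕ) (X : Fin t → Finset V), IsPathDecomp G t X ∧ ∀ i, (X i).card ≤ k + 1

/-- The pathwidth of `G`. -/
noncomputable def pathwidth {V : Type*} (G : SimpleGraph V) : ℕ :=
  sInf {k | pathwidthLE G k}

/-- Path decompositions pull back along injective homomorphisms. -/
theorem IsPathDecomp.preimage {V W : Type*} {G : SimpleGraph V} {H : SimpleGraph W} {t : ℕ}
    {X : Fin t → Finset V} (hX : IsPathDecomp G t X) (f : H →g G) (hf : Function.Injective f) :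
    IsPathDecomp H t fun i ↦ (X i).preimage f hf.injOn := by
  obtain ⟨hcover, hadj, hint⟩ := hX
  refine ⟨fun v ↦ ?_, fun u v huv ↦ ?_, fun v i j l hij hjl hi hl ↦ ?_⟩
  · simpa using hcover (f v)
  · simpa using hadj (f.map_adj huv)
  · simp only [Finset.mem_preimage] at hi hl ⊢
    exact hint (f v) i j l hij hjl hi hl

/-- A walk between two bags of a path decomposition meets every bag in between. -/
theorem IsPathDecomp.exists_mem_support {V : Type*} {G : SimpleGraph V} {t : ℕ}
    {X : Fin t → Finset V} (hX : IsPathDecomp G t X) {u v : V} (p : G.Walk u v)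
    {a i b : Fin t} (hu : u ∈ X a) (hv : v ∈ X b) (hai : a ≤ i) (hib : i ≤ b) :
    ∃ w ∈ p.support, w ∈ X i := by
  induction p generalizing a with
  | nil => exact ⟨_, by simp, hX.2.2 _ a i b hai hib hu hv⟩
  | @cons u w v huw p ih =>
    obtain ⟨j, huj, hwj⟩ := hX.2.1 huw
    rcases le_total i j with hij | hji
    · exact ⟨u, by simp, hX.2.2 u a i j hai hij hu huj⟩
    · obtain ⟨x, hxp, hxi⟩ := ih hwj hv hji
      exact ⟨x, by simp [hxp], hxi⟩

/-- In a connected graph some path meets every nonempty bag of a given path decomposition. -/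
theorem IsPathDecomp.exists_isPath_meeting_bags {V : Type*} {G : SimpleGraph V}
    (hG : G.Connected) {t : ℕ} {X : Fin t → Finset V} (hX : IsPathDecomp G t X) :
    ∃ (u v : V) (p : G.Walk u v), p.IsPath ∧
      ∀ i, (X i).Nonempty → ∃ w ∈ p.support, w ∈ X i := by
  classical
  obtain ⟨v₀⟩ := hG.nonempty
  obtain ⟨i₀, hi₀⟩ := hX.1 v₀
  let S : Finset (Fin t) := {i | (X i).Nonempty}
  have hS : S.Nonempty := ⟨i₀, by simpa [S] using ⟨v₀, hi₀⟩⟩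
  obtain ⟨u, hu⟩ : (X (S.min' hS)).Nonempty := by simpa [S] using S.min'_mem hS
  obtain ⟨v, hv⟩ : (X (S.max' hS)).Nonempty := by simpa [S] using S.max'_mem hS
  obtain ⟨p, hp⟩ := (hG u v).exists_isPath
  refine ⟨u, v, p, hp, fun i hi ↦ ?_⟩
  have hiS : i ∈ S := by simpa [S] using hi
  exact hX.exists_mem_support p hu hv (S.min'_le i hiS) (S.le_max' i hiS)

/-- A nonzero pathwidth is attained by some path decomposition. -/
theorem pathwidthLE_pathwidth {V : Type*} {G : SimpleGraph V} (h : 0 < pathwidth G) :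
    pathwidthLE G (pathwidth G) :=
  Nat.sInf_mem (Nat.nonempty_of_pos_sInf h)

/-- **Lemma.** Let `T` be a tree of pathwidth `ℓ ≥ 2`.  Then there is a simple path `P` in `T`
such that deleting the vertices of `P` from `T` leaves a forest each of whose connected
components has pathwidth at most `ℓ - 1`. -/
theorem exists_path_pathwidth_decomposition {V : Type} [Fintype V]
    (T : SimpleGraph V) (hT : T.IsTree) (ℓ : ℕ) (hℓ : 2 ≤ ℓ) (hpw : pathwidth T = ℓ) :
    ∃ (u v : V) (P : T.Walk u v), P.IsPath ∧
      ∀ c : (T.induce {w : V | w ∉ P.support}).ConnectedComponent,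
        pathwidthLE ((T.induce {w : V | w ∉ P.support}).induce c.supp) (ℓ - 1) := by
  obtain ⟨t, X, hX, hcard⟩ := pathwidthLE_pathwidth (G := T) (by omega)
  obtain ⟨u, v, p, hp, hmeet⟩ := hX.exists_isPath_meeting_bags hT.connected
  refine ⟨u, v, p, hp, fun c ↦ ?_⟩
  let f : (T.induce {w : V | w ∉ p.support}).induce c.supp →g T :=
    (SimpleGraph.Embedding.induce _).toHom.comp (SimpleGraph.Embedding.induce _).toHom
  have hf : Function.Injective f := Subtype.val_injective.comp Subtype.val_injective
  refine ⟨t, _, hX.preimage f hf, fun i ↦ ?_⟩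
  classical
  rcases (X i).eq_empty_or_nonempty with hi | hi
  · simp [hi]
  · obtain ⟨w, hwp, hwi⟩ := hmeet i hi
    have hlt : ((X i).preimage f hf.injOn).card < (X i).card := by
      rw [← Finset.card_image_of_injective _ hf]
      refine Finset.card_lt_card ⟨Finset.image_subset_iff.mpr (by simp), fun hsub ↦ ?_⟩
      obtain ⟨x, -, rfl⟩ := Finset.mem_image.mp (hsub hwi)
      exact x.1.2 hwp
    have := hcard i
    omega
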